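/- arXiv:1512.07338 — 3 statements merged into one kernel-verified Lean document; each statement's English description precedes it below -/
import Mathlib

section
/- Suppose N = aK + r with integers a ≥ 1, K ≥ 2, and 0 ≤ r < a. Then FC(N) ≤ FC(K) + FC(2a + r). -/
/-- An adaptive strategy for balance weighings on `N` coins: a ternary decision
tree.  At a `weigh A B` node the sets `A` and `B` are placed on the two pans,
and the strategy branches on the outcome (`.lt`: left pan lighter, `.eq`:
balance, `.gt`: right pan lighter).  A leaf `output S` outputs the set `S` of
coins. -/
inductive FCTree (N : ℕ) : Type
  | output (S : Finset (Fin N)) : FCTree N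
  | weigh (A B : Finset (Fin N)) (child : Ordering → FCTree N) : FCTree N

namespace FCTree

/-- The depth (number of weighings in the worst case) of a strategy. -/
def depth {N : ℕ} : FCTree N → ℕ
  | output _ => 0
  | weigh _ _ child =>
      1 + max (depth (child .lt)) (max (depth (child .eq)) (depth (child .gt)))

/-- A strategy is well-formed if in every weighing the two pans are disjoint. -/
def WF {N : ℕ} : FCTree N → Prop
  | output _ => True
  | weigh A B child => Disjoint A B ∧ ∀ o, WF (child o)

end FCTree

/-- Weight of coin `x` when `f` is the fake coin, `c` is the chameleon, and the
chameleon chooses to weigh as a fake coin iff `b = true`.  Real coins weigh `1`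
and the (lighter) fake coin weighs `0`. -/
def coinWeight {N : ℕ} (f c : Fin N) (b : Bool) (x : Fin N) : ℕ :=
  if x = f then 0 else if x = c ∧ b = true then 0 else 1

/-- The outcome of weighing pan `A` against pan `B`, with fake `f`, chameleon
`c`, and chameleon choice `b`. -/
def weighOutcome {N : ℕ} (f c : Fin N) (b : Bool) (A B : Finset (Fin N)) : Ordering :=
  compare (∑ x ∈ A, coinWeight f c b x) (∑ x ∈ B, coinWeight f c b x)

/-- `Reaches f c t S` holds if, with fake coin `f` and chameleon `c`, some
sequence of choices by the chameleon (one choice before each weighing,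
independently) leads the strategy `t` to output the set `S`. -/
inductive Reaches {N : ℕ} (f c : Fin N) : FCTree N → Finset (Fin N) → Prop
  | output (S : Finset (Fin N)) : Reaches f c (.output S) S
  | weigh (A B : Finset (Fin N)) (child : Ordering → FCTree N) (b : Bool)
      (S : Finset (Fin N)) :
      Reaches f c (child (weighOutcome f c b A B)) S →
      Reaches f c (.weigh A B child) S

/-- `t` is an FC-solution for `N` coins in `w` weighings: a well-formed strategy
of depth at most `w` which, for every placement of the fake coin and the
chameleon and every sequence of choices by the chameleon, outputs a set of at
most 2 coins containing the fake coin. -/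
def IsFCSolution {N : ℕ} (t : FCTree N) (w : ℕ) : Prop :=
  t.WF ∧ t.depth ≤ w ∧
    ∀ f c : Fin N, f ≠ c → ∀ S, Reaches f c t S → S.card ≤ 2 ∧ f ∈ S

/-- There is an FC-algorithm in `w` weighings for `N` coins. -/
def FCAlgorithm (N w : ℕ) : Prop := ∃ t : FCTree N, IsFCSolution t w

/-- `FC N` is the least number of weighings `w` for which an FC-algorithm in
`w` weighings for `N` coins exists. -/
noncomputable def FC (N : ℕ) : ℕ := sInf {w | FCAlgorithm N w}

/-- Weight of coin `x` in the FF-problem with fake coins `f₁` and `f₂`. -/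
def ffWeight {N : ℕ} (f₁ f₂ x : Fin N) : ℕ := if x = f₁ ∨ x = f₂ then 0 else 1

/-- The (deterministic) run of a strategy in the FF-problem with fake coins
`f₁` and `f₂`; it returns the output set. -/
def ffRun {N : ℕ} (f₁ f₂ : Fin N) : FCTree N → Finset (Fin N)
  | .output S => S
  | .weigh A B child =>
      ffRun f₁ f₂
        (child (compare (∑ x ∈ A, ffWeight f₁ f₂ x) (∑ x ∈ B, ffWeight f₁ f₂ x)))

/-- There is an FF-algorithm in `w` weighings for `N` coins: a well-formed
strategy of depth at most `w` that identifies both fake coins for every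
placement of the two fake coins. -/
def FFAlgorithm (N w : ℕ) : Prop :=
  ∃ t : FCTree N, t.WF ∧ t.depth ≤ w ∧
    ∀ f₁ f₂ : Fin N, f₁ ≠ f₂ → ffRun f₁ f₂ t = {f₁, f₂}

/-- The group (of three coins) to which a coin of the scaled problem belongs. -/
def coinGroup {N : ℕ} (x : Fin (3 * N)) : Fin N :=
  ⟨x.val / 3, by have := x.isLt; omega⟩

/-- The set of coins of the scaled problem whose group lies in `A`. -/
def expandPan {N : ℕ} (A : Finset (Fin N)) : Finset (Fin (3 * N)) :=
  Finset.univ.filter (fun x => coinGroup x ∈ A)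

/-- The scaling of a strategy, extended at the leaves: every coin is replaced
by a group of three coins, every weighing is performed on the corresponding
groups, and every leaf `output S` is replaced by the strategy `ext S`. -/
def scaleExtend {N : ℕ} (ext : Finset (Fin N) → FCTree (3 * N)) :
    FCTree N → FCTree (3 * N)
  | .output S => ext S
  | .weigh A B child =>
      .weigh (expandPan A) (expandPan B) (fun o => scaleExtend ext (child o))

/-- A `(w,N)`-solution `t` is scalable if its scaling can be extended by (at
most) two further weighings at each leaf to a `(w+2, 3N)`-solution. -/
def IsScalable {N : ℕ} (t : FCTree N) (w : ℕ) : Prop :=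
  ∃ ext : Finset (Fin N) → FCTree (3 * N),
    (∀ S, (ext S).WF ∧ (ext S).depth ≤ 2) ∧
    IsFCSolution (scaleExtend ext t) (w + 2)

/-- `Solvable w S` holds if some strategy with at most `w` weighings outputs at most two coins,
among them the fake one, whenever the pair (fake coin, chameleon) is known to satisfy `S`. -/
def Solvable {N : ℕ} (w : ℕ) (S : Fin N → Fin N → Prop) : Prop :=
  ∃ t : FCTree N, t.WF ∧ t.depth ≤ w ∧
    ∀ f c : Fin N, f ≠ c → S f c → ∀ O, Reaches f c t O → O.card ≤ 2 ∧ f ∈ O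

lemma sum_coinWeight {N : ℕ} {f c : Fin N} (hfc : f ≠ c) (b : Bool) (A : Finset (Fin N)) :
    ∑ x ∈ A, coinWeight f c b x + ((if f ∈ A then 1 else 0) +
      (if c ∈ A ∧ b = true then 1 else 0)) = A.card := by
  have h1 : (if f ∈ A then 1 else 0) = ∑ x ∈ A, if x = f then 1 else 0 := by simp
  have h2 : (if c ∈ A ∧ b = true then 1 else 0) =
      ∑ x ∈ A, if x = c ∧ b = true then 1 else 0 := by
    cases b <;> simp
  rw [h1, h2, ← Finset.sum_add_distrib, ← Finset.sum_add_distrib, Finset.card_eq_sum_ones]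
  refine Finset.sum_congr rfl fun x _ => ?_
  unfold coinWeight
  grind

namespace Solvable

variable {N w w' : ℕ} {S S' : Fin N → Fin N → Prop} {A B : Finset (Fin N)}

lemma mono (h : Solvable w S) (hw : w ≤ w') (hS : ∀ f c, f ≠ c → S' f c → S f c) :
    Solvable w' S' := by
  obtain ⟨t, h1, h2, h3⟩ := h
  exact ⟨t, h1, h2.trans hw, fun f c hfc hs => h3 f c hfc (hS f c hfc hs)⟩

lemma of_card_le_two (hA : A.card ≤ 2) (hS : ∀ f c, f ≠ c → S f c → f ∈ A) : Solvable w S := by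
  refine ⟨.output A, trivial, Nat.zero_le _, fun f c hfc hs O hO => ?_⟩
  cases hO
  exact ⟨hA, hS f c hfc hs⟩

/-- One weighing with pans of equal cardinality, followed by a strategy for each outcome. -/
lemma weigh (hd : Disjoint A B) (hc : A.card = B.card)
    (hlt : Solvable w fun f c => S f c ∧ (f ∈ A ∨ f ∉ B ∧ c ∈ A))
    (heq : Solvable w fun f c => S f c ∧
      (f ∉ A ∧ f ∉ B ∨ f ∈ A ∧ c ∈ B ∨ f ∈ B ∧ c ∈ A))
    (hgt : Solvable w fun f c => S f c ∧ (f ∈ B ∨ f ∉ A ∧ c ∈ B)) :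
    Solvable (w + 1) S := by
  obtain ⟨t₁, hw₁, hd₁, h₁⟩ := hlt
  obtain ⟨t₂, hw₂, hd₂, h₂⟩ := heq
  obtain ⟨t₃, hw₃, hd₃, h₃⟩ := hgt
  refine ⟨.weigh A B fun o => match o with | .lt => t₁ | .eq => t₂ | .gt => t₃,
    ⟨hd, fun o => by cases o <;> assumption⟩, ?_, ?_⟩
  · simp only [FCTree.depth]
    omega
  · intro f c hfc hs O hO
    cases hO with
    | weigh _ _ _ b _ hO =>
      have ha := sum_coinWeight hfc b A
      have hb := sum_coinWeight hfc b B
      have hdis := Finset.disjoint_left.1 hd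
      cases ho : weighOutcome f c b A B with
      | lt =>
        rw [ho] at hO
        rw [weighOutcome, Nat.compare_eq_lt] at ho
        exact h₁ f c hfc ⟨hs, by grind⟩ O hO
      | eq =>
        rw [ho] at hO
        rw [weighOutcome, Nat.compare_eq_eq] at ho
        exact h₂ f c hfc ⟨hs, by grind⟩ O hO
      | gt =>
        rw [ho] at hO
        rw [weighOutcome, Nat.compare_eq_gt] at ho
        exact h₃ f c hfc ⟨hs, by grind⟩ O hO

end Solvable

lemma Finset.exists_split {α : Type*} [DecidableEq α] (X : Finset α) {m n : ℕ}
    (h : X.card = m + n) :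
    ∃ Y Z : Finset α, Y.card = m ∧ Z.card = n ∧ (∀ x, x ∈ X ↔ x ∈ Y ∨ x ∈ Z) ∧
      ∀ x, x ∈ Y → x ∉ Z := by
  obtain ⟨Y, hY, hm⟩ := Finset.exists_subset_card_eq (show m ≤ X.card by omega)
  refine ⟨Y, X \ Y, hm, ?_, ?_, ?_⟩
  · rw [Finset.card_sdiff_of_subset hY]; omega
  · intro x; have := @hY x; simp only [Finset.mem_sdiff]; tauto
  · intro x hx; simp [hx]

lemma Finset.exists_split_three {α : Type*} [DecidableEq α] (X : Finset α) {l m n : ℕ}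
    (h : X.card = l + m + n) :
    ∃ Y Z W : Finset α, Y.card = l ∧ Z.card = m ∧ W.card = n ∧
      (∀ x, x ∈ X ↔ x ∈ Y ∨ x ∈ Z ∨ x ∈ W) ∧
      ∀ x, (x ∈ Y → x ∉ Z) ∧ (x ∈ Y → x ∉ W) ∧ (x ∈ Z → x ∉ W) := by
  obtain ⟨Y, V, hY, hV, hX, hYV⟩ := X.exists_split (show X.card = l + (m + n) by omega)
  obtain ⟨Z, W, hZ, hW, hV, hZW⟩ := V.exists_split hV
  exact ⟨Y, Z, W, hY, hZ, hW, by grind, by grind⟩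

section Components

variable {N : ℕ}

/-- The fake coin lies in `X`, the chameleon does not. -/
def DirectedState (X : Finset (Fin N)) (f c : Fin N) : Prop := f ∈ X ∧ c ∉ X

/-- The fake coin lies in `P` or in `R`, and the chameleon does not lie in the same set. -/
def BipartiteState (P R : Finset (Fin N)) (f c : Fin N) : Prop :=
  (f ∈ P ∧ c ∉ P) ∨ (f ∈ R ∧ c ∉ R)

/-- The fake coin lies in `X`; nothing is known about the chameleon. -/
def FullState (X : Finset (Fin N)) (f _c : Fin N) : Prop := f ∈ X

lemma solvable_directedState (j : ℕ) (X : Finset (Fin N)) (hX : X.card ≤ 2 * 3 ^ j) :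
    Solvable j (DirectedState X) := by
  induction j generalizing X with
  | zero => exact .of_card_le_two hX fun f c _ h => h.1
  | succ j ih =>
    rw [pow_succ] at hX
    obtain ⟨m, n, hmn, hm, hn⟩ : ∃ m n, X.card = m + m + n ∧ m ≤ 2 * 3 ^ j ∧ n ≤ 2 * 3 ^ j := by
      exact ⟨min (2 * 3 ^ j) (X.card / 2), X.card - 2 * min (2 * 3 ^ j) (X.card / 2),
        by omega, by omega, by omega⟩
    obtain ⟨Y, Z, W, hY, hZ, hW, hU, hD⟩ := X.exists_split_three hmn
    refine .weigh (A := Y) (B := Z) (Finset.disjoint_left.2 fun x => (hD x).1) (by omega) ?_ ?_ ?_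
    · exact (ih Y (by omega)).mono le_rfl (by unfold DirectedState; grind)
    · exact (ih W (by omega)).mono le_rfl (by unfold DirectedState; grind)
    · exact (ih Z (by omega)).mono le_rfl (by unfold DirectedState; grind)

lemma bipartiteState_comm (P R : Finset (Fin N)) (f c : Fin N) :
    BipartiteState P R f c ↔ BipartiteState R P f c := or_comm

/-- A weighing splits one side of a bipartite state into three parts. -/
lemma solvable_bipartiteState_succ {w u : ℕ} {P R : Finset (Fin N)} (hP : P.card ≤ 3 * u)
    (h : ∀ Q : Finset (Fin N), Q.card ≤ u → Solvable w (BipartiteState Q R)) :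
    Solvable (w + 1) (BipartiteState P R) := by
  obtain ⟨m, n, hmn, hm, hn⟩ : ∃ m n, P.card = m + m + n ∧ m ≤ u ∧ n ≤ u :=
    ⟨min u (P.card / 2), P.card - 2 * min u (P.card / 2), by omega, by omega, by omega⟩
  obtain ⟨Y, Z, W, hY, hZ, hW, hU, hD⟩ := P.exists_split_three hmn
  refine .weigh (A := Y) (B := Z) (Finset.disjoint_left.2 fun x => (hD x).1) (by omega) ?_ ?_ ?_
  · exact (h Y (by omega)).mono le_rfl (by unfold BipartiteState; grind)
  · exact (h W (by omega)).mono le_rfl (by unfold BipartiteState; grind)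
  · exact (h Z (by omega)).mono le_rfl (by unfold BipartiteState; grind)

lemma solvable_bipartiteState (i j : ℕ) (P R : Finset (Fin N)) (hP : P.card ≤ 3 ^ i)
    (hR : R.card ≤ 3 ^ j) : Solvable (i + j) (BipartiteState P R) := by
  induction i generalizing P with
  | zero =>
    induction j generalizing R with
    | zero =>
      refine .of_card_le_two (A := P ∪ R) ((Finset.card_union_le _ _).trans ?_) ?_
      · simp at hP hR
        omega
      · unfold BipartiteState
        grind
    | succ j ih =>
      exact (solvable_bipartiteState_succ (P := R) (R := P) (w := 0 + j) (u := 3 ^ j)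
        (by rw [pow_succ] at hR; omega) fun Q hu =>
          (ih Q hu).mono le_rfl fun f c _ h => (bipartiteState_comm _ _ _ _).1 h).mono le_rfl
        fun f c _ h => (bipartiteState_comm _ _ _ _).1 h
  | succ i ih =>
    exact (solvable_bipartiteState_succ (w := i + j) (u := 3 ^ i)
      (by rw [pow_succ] at hP; omega) fun Q hu => ih Q hu).mono (by omega) fun f c _ h => h

lemma card_union_of_forall_notMem {α : Type*} [DecidableEq α] {A B : Finset α}
    (h : ∀ x, x ∈ A → x ∉ B) : (A ∪ B).card = A.card + B.card :=
  Finset.card_union_of_disjoint (Finset.disjoint_left.2 h)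

/-- The information after `P` turned out lighter in a weighing, `R` being the set of coins left
off the pans. -/
def UnbalancedState (P R : Finset (Fin N)) (f c : Fin N) : Prop := f ∈ P ∨ f ∈ R ∧ c ∈ P

/-- The information after a balanced weighing of `P` against `Q`, the other coins forming `R`. -/
def BalancedState (P Q R : Finset (Fin N)) (f c : Fin N) : Prop :=
  (f ∈ P ∧ c ∈ Q) ∨ (f ∈ Q ∧ c ∈ P) ∨ f ∈ R

lemma solvable_unbalancedState {w : ℕ} {P Q R : Finset (Fin N)}
    (hD : ∀ x, (x ∈ P → x ∉ Q) ∧ (x ∈ P → x ∉ R) ∧ (x ∈ Q → x ∉ R)) (hQ : 0 < Q.card)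
    (hb : ∀ V : Finset (Fin N), 2 * V.card ≤ R.card + 1 → Solvable w (BipartiteState P V))
    (hf : Solvable w (FullState P)) : Solvable (w + 1) (UnbalancedState P R) := by
  obtain ⟨R₁, R₂, h₁, h₂, hU, hR⟩ :=
    R.exists_split (show R.card = R.card / 2 + (R.card - R.card / 2) by omega)
  obtain ⟨E, E', hE, hE', hQE, hEE⟩ := Q.exists_split
    (show Q.card = (R.card - 2 * (R.card / 2)) + (Q.card - (R.card - 2 * (R.card / 2))) by omega)
  have hc : (R₁ ∪ E).card = R₁.card + E.card := card_union_of_forall_notMem (by grind)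
  refine .weigh (A := R₁ ∪ E) (B := R₂) (Finset.disjoint_left.2 (by grind)) (by omega) ?_ ?_ ?_
  · exact (hb R₁ (by omega)).mono le_rfl (by unfold UnbalancedState BipartiteState; grind)
  · exact hf.mono le_rfl (by unfold UnbalancedState FullState; grind)
  · exact (hb R₂ (by omega)).mono le_rfl (by unfold UnbalancedState BipartiteState; grind)

lemma solvable_fullState_of_balancedState {w : ℕ} {P Q R X : Finset (Fin N)}
    (hD : ∀ x, (x ∈ P → x ∉ Q) ∧ (x ∈ P → x ∉ R) ∧ (x ∈ Q → x ∉ R))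
    (hX : ∀ x, x ∈ X ↔ x ∈ P ∨ x ∈ Q ∨ x ∈ R)
    (hPQ : P.card = Q.card) (hP : 0 < P.card)
    (hb : ∀ U V : Finset (Fin N), U.card = P.card → 2 * V.card ≤ R.card + 1 →
      Solvable w (BipartiteState U V))
    (hf : ∀ U : Finset (Fin N), U.card = P.card → Solvable w (FullState U))
    (hz : Solvable (w + 1) (BalancedState P Q R)) : Solvable (w + 2) (FullState X) := by
  refine .weigh (A := P) (B := Q) (Finset.disjoint_left.2 (by grind)) hPQ ?_ ?_ ?_
  · exact (solvable_unbalancedState hD (by omega) (fun V => hb P V rfl) (hf P rfl)).mono le_rfl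
      (by unfold UnbalancedState FullState; grind)
  · exact hz.mono le_rfl (by unfold BalancedState FullState; grind)
  · exact (solvable_unbalancedState (P := Q) (Q := P) (R := R) (by grind) hP
      (fun V => hb Q V hPQ.symm) (hf Q hPQ.symm)).mono le_rfl
      (by unfold UnbalancedState FullState; grind)

/-- A general splitting of the coins for the first weighing, solving the balanced case by
comparing `R` with `Q` and a part of `P`. -/
lemma solvable_fullState_of_le {w p r : ℕ} {X : Finset (Fin N)} (hX : X.card = p + p + r)
    (hp : 0 < p) (hpr : p ≤ r) (hrp : r ≤ 2 * p)
    (hb : ∀ U V : Finset (Fin N), U.card = p → V.card ≤ p → Solvable w (BipartiteState U V))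
    (hf : ∀ U : Finset (Fin N), U.card ≤ r → Solvable w (FullState U))
    (hd : ∀ U : Finset (Fin N), U.card ≤ 2 * p → Solvable w (DirectedState U)) :
    Solvable (w + 2) (FullState X) := by
  obtain ⟨P, Q, R, hP, hQ, hR, hU, hD⟩ := X.exists_split_three hX
  refine solvable_fullState_of_balancedState hD hU (by omega) (by omega)
    (fun U V hU hV => hb U V (by omega) (by omega)) (fun U hU => hf U (by omega)) ?_
  obtain ⟨P', P'', hP', hP'', hPU, hPD⟩ :=
    P.exists_split (show P.card = (r - p) + (2 * p - r) by omega)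
  have hc : (Q ∪ P').card = Q.card + P'.card := card_union_of_forall_notMem (by grind)
  have hc' : (P'' ∪ R).card = P''.card + R.card := card_union_of_forall_notMem (by grind)
  refine .weigh (A := R) (B := Q ∪ P') (Finset.disjoint_left.2 (by grind)) (by omega) ?_ ?_ ?_
  · exact (hf R hR.le).mono le_rfl (by unfold BalancedState FullState; grind)
  · exact (hd (P'' ∪ R) (by omega)).mono le_rfl (by unfold BalancedState DirectedState; grind)
  · exact (hb P Q hP hQ.le).mono le_rfl (by unfold BalancedState BipartiteState; grind)

lemma solvable_fullState_five {X : Finset (Fin N)} (hX : X.card = 5) :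
    Solvable 3 (FullState X) := by
  obtain ⟨P, Q, R, hP, hQ, hR, hU, hD⟩ := X.exists_split_three (show X.card = 2 + 2 + 1 from hX)
  refine solvable_fullState_of_balancedState (w := 1) hD hU (by omega) (by omega)
    (fun U V hU hV => solvable_bipartiteState 1 0 U V (by omega) (by omega))
    (fun U hU => .of_card_le_two (A := U) (by omega) fun f c _ h => h) ?_
  obtain ⟨Q₁, Q₂, hQ₁, hQ₂, hQU, hQD⟩ := Q.exists_split (show Q.card = 1 + 1 by omega)
  obtain ⟨P₁, P₂, hP₁, hP₂, hPU, hPD⟩ := P.exists_split (show P.card = 1 + 1 by omega)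
  refine .weigh (A := R) (B := Q₁) (Finset.disjoint_left.2 (by grind)) (by omega) ?_ ?_ ?_
  · exact .of_card_le_two (A := R) (by omega) (by unfold BalancedState; grind)
  · refine .weigh (A := P₁) (B := P₂) (Finset.disjoint_left.2 (by grind)) (by omega) ?_ ?_ ?_
    · refine .of_card_le_two (A := P₁ ∪ Q₂) ((Finset.card_union_le _ _).trans (by omega)) ?_
      unfold BalancedState
      grind
    · refine .of_card_le_two (A := R ∪ Q₂) ((Finset.card_union_le _ _).trans (by omega)) ?_
      unfold BalancedState
      grind
    · refine .of_card_le_two (A := P₂ ∪ Q₂) ((Finset.card_union_le _ _).trans (by omega)) ?_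
      unfold BalancedState
      grind
  · exact (solvable_bipartiteState 1 0 P Q₁ (by omega) (by omega)).mono le_rfl
      (by unfold BalancedState BipartiteState; grind)

lemma solvable_fullState_even (j : ℕ) (X : Finset (Fin N)) (hX : X.card ≤ 3 ^ j + 1) :
    Solvable (2 * j) (FullState X) := by
  induction j generalizing X with
  | zero => exact .of_card_le_two hX fun f c _ h => h
  | succ j ih =>
    rw [pow_succ] at hX
    have hj : 0 < 3 ^ j := by positivity
    by_cases h2 : X.card ≤ 2
    · exact (Solvable.of_card_le_two (w := 0) h2 fun f c _ h => h).mono (by omega) fun f c _ h => h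
    by_cases h5 : X.card = 5
    · have : j ≠ 0 := by rintro rfl; omega
      exact (solvable_fullState_five h5).mono (by omega) fun f c _ h => h
    exact solvable_fullState_of_le (w := 2 * j) (p := X.card / 3) (r := X.card - 2 * (X.card / 3))
      (by omega) (by omega) (by omega) (by omega)
      (fun U V hU hV => (solvable_bipartiteState j j U V (by omega) (by omega)).mono (by omega)
        fun f c _ h => h)
      (fun U hU => ih U (by omega))
      (fun U hU => (solvable_directedState j U (by omega)).mono (by omega) fun f c _ h => h)

lemma Finset.exists_padding {α : Type*} [DecidableEq α] (E : Finset α) {m n : ℕ}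
    (hm : m ≤ n + E.card) (hn : n ≤ m + E.card) :
    ∃ E₁ E₂ : Finset α, (∀ x, x ∈ E₁ → x ∈ E) ∧ (∀ x, x ∈ E₂ → x ∈ E) ∧
      (∀ x, x ∈ E₁ → x ∉ E₂) ∧ m + E₁.card = n + E₂.card := by
  rcases le_total m n with h | h
  · obtain ⟨E₁, hE, hc⟩ := Finset.exists_subset_card_eq (show n - m ≤ E.card by omega)
    exact ⟨E₁, ∅, hE, by simp, by simp, by simp; omega⟩
  · obtain ⟨E₂, hE, hc⟩ := Finset.exists_subset_card_eq (show m - n ≤ E.card by omega)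
    exact ⟨∅, E₂, by simp, hE, by simp, by simp; omega⟩

/-- Weighing `A` against `B`, with coins of `E` added to one of the pans to equalise the
cardinalities. -/
lemma Solvable.weigh_padded {w : ℕ} {S : Fin N → Fin N → Prop} {A B : Finset (Fin N)}
    (E : Finset (Fin N)) (hD : ∀ x, (x ∈ A → x ∉ B) ∧ (x ∈ A → x ∉ E) ∧ (x ∈ B → x ∉ E))
    (hA : A.card ≤ B.card + E.card) (hB : B.card ≤ A.card + E.card)
    (hlt : Solvable w fun f c => S f c ∧ (f ∈ A ∨ f ∈ E ∨ f ∉ B ∧ (c ∈ A ∨ c ∈ E)))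
    (heq : Solvable w fun f c => S f c ∧
      (f ∉ A ∧ f ∉ B ∨ f ∈ A ∧ (c ∈ B ∨ c ∈ E) ∨ f ∈ B ∧ (c ∈ A ∨ c ∈ E)))
    (hgt : Solvable w fun f c => S f c ∧ (f ∈ B ∨ f ∈ E ∨ f ∉ A ∧ (c ∈ B ∨ c ∈ E))) :
    Solvable (w + 1) S := by
  obtain ⟨E₁, E₂, h₁, h₂, hE, hc⟩ := E.exists_padding hA hB
  have hA' : (A ∪ E₁).card = A.card + E₁.card := card_union_of_forall_notMem (by grind)
  have hB' : (B ∪ E₂).card = B.card + E₂.card := card_union_of_forall_notMem (by grind)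
  refine .weigh (A := A ∪ E₁) (B := B ∪ E₂) (Finset.disjoint_left.2 (by grind)) (by omega) ?_ ?_ ?_
  · exact hlt.mono le_rfl (by grind)
  · exact heq.mono le_rfl (by grind)
  · exact hgt.mono le_rfl (by grind)

/-- A balanced state in which `P` and `Q` have `x + y + d` coins and `R` has `2 * y + d` coins. -/
lemma solvable_balancedState {w u x y d : ℕ} {P Q R : Finset (Fin N)}
    (hD : ∀ z, (z ∈ P → z ∉ Q) ∧ (z ∈ P → z ∉ R) ∧ (z ∈ Q → z ∉ R))
    (hP : P.card = x + (y + d)) (hQ : Q.card = (x + d) + y) (hR : R.card = y + (y + d))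
    (hx : x + d ≤ u) (hy : y + d ≤ u) (hxy : x ≤ 3 * y)
    (hb : ∀ U V : Finset (Fin N), U.card ≤ u → V.card ≤ u → Solvable w (BipartiteState U V))
    (hf : ∀ U : Finset (Fin N), U.card ≤ u → Solvable w (FullState U))
    (hd : ∀ U : Finset (Fin N), U.card ≤ 2 * u → Solvable w (DirectedState U)) :
    Solvable (w + 2) (BalancedState P Q R) := by
  obtain ⟨P₁, P₂, hP₁, hP₂, hPU, hPD⟩ := P.exists_split hP
  obtain ⟨Q₁, Q₂, hQ₁, hQ₂, hQU, hQD⟩ := Q.exists_split hQ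
  obtain ⟨R₁, R₂, hR₁, hR₂, hRU, hRD⟩ := R.exists_split hR
  have h₁ : (Q₁ ∪ R₁).card = Q₁.card + R₁.card := card_union_of_forall_notMem (by grind)
  have h₂ : (P₁ ∪ R₂).card = P₁.card + R₂.card := card_union_of_forall_notMem (by grind)
  have h₃ : (Q₂ ∪ R₂).card = Q₂.card + R₂.card := card_union_of_forall_notMem (by grind)
  have h₄ : (P₂ ∪ R₁).card = P₂.card + R₁.card := card_union_of_forall_notMem (by grind)
  have h₅ : (P₂ ∪ Q₂).card = P₂.card + Q₂.card := card_union_of_forall_notMem (by grind)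
  have h₆ : (R₁ ∪ R₂).card = R₁.card + R₂.card := card_union_of_forall_notMem (by grind)
  refine .weigh (A := Q₁ ∪ R₁) (B := P₁ ∪ R₂) (Finset.disjoint_left.2 (by grind))
    (by omega) ?_ ?_ ?_
  · refine .weigh_padded (A := R₁) (B := Q₁) (Q₂ ∪ R₂) (by grind) (by omega) (by omega) ?_ ?_ ?_
    · exact (hf R₁ (by omega)).mono le_rfl (by unfold BalancedState FullState; grind)
    · exact (hd (P₂ ∪ R₁) (by omega)).mono le_rfl (by unfold BalancedState DirectedState; grind)
    · exact (hb P₂ Q₁ (by omega) (by omega)).mono le_rfl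
        (by unfold BalancedState BipartiteState; grind)
  · refine .weigh (A := P₂ ∪ Q₂) (B := R₁ ∪ R₂) (Finset.disjoint_left.2 (by grind))
      (by omega) ?_ ?_ ?_
    · exact (hb P₂ Q₂ (by omega) (by omega)).mono le_rfl
        (by unfold BalancedState BipartiteState; grind)
    · exact (hb P₁ Q₁ (by omega) (by omega)).mono le_rfl
        (by unfold BalancedState BipartiteState; grind)
    · exact (hb R₁ R₂ (by omega) (by omega)).mono le_rfl
        (by unfold BalancedState BipartiteState; grind)
  · refine .weigh_padded (A := R₂) (B := P₁) (P₂ ∪ R₁) (by grind) (by omega) (by omega) ?_ ?_ ?_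
    · exact (hf R₂ (by omega)).mono le_rfl (by unfold BalancedState FullState; grind)
    · exact (hd (Q₂ ∪ R₂) (by omega)).mono le_rfl (by unfold BalancedState DirectedState; grind)
    · exact (hb P₁ Q₂ (by omega) (by omega)).mono le_rfl
        (by unfold BalancedState BipartiteState; grind)

lemma solvable_fullState_odd (k : ℕ) (X : Finset (Fin N)) (hX : X.card + 2 ^ k ≤ 6 * 3 ^ k) :
    Solvable (2 * k + 3) (FullState X) := by
  induction k generalizing X with
  | zero =>
    by_cases h5 : X.card = 5
    · exact solvable_fullState_five h5
    · exact (solvable_fullState_even 1 X (by omega)).mono (by omega) fun f c _ h => h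
  | succ k ih =>
    by_cases hE : X.card ≤ 3 ^ (k + 1 + 1) + 1
    · exact (solvable_fullState_even _ X hE).mono (by omega) fun f c _ h => h
    have hb : ∀ U V : Finset (Fin N), U.card ≤ 3 ^ (k + 1) → V.card ≤ 3 ^ (k + 1) →
        Solvable (2 * (k + 1)) (BipartiteState U V) := fun U V hU hV =>
      (solvable_bipartiteState (k + 1) (k + 1) U V hU hV).mono (by omega) fun f c _ h => h
    have hb' : ∀ U V : Finset (Fin N), U.card ≤ 3 ^ (k + 2) → V.card ≤ 3 ^ (k + 1) →
        Solvable (2 * (k + 1) + 1) (BipartiteState U V) := fun U V hU hV =>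
      (solvable_bipartiteState (k + 2) (k + 1) U V hU hV).mono (by omega) fun f c _ h => h
    have hk : 2 ^ k ≤ 3 ^ k := Nat.pow_le_pow_left (by norm_num) k
    have hk' : 0 < 2 ^ k := by positivity
    simp only [pow_succ] at hX hE hb' hb ih
    obtain ⟨x, y, d, hn, hx, hy, hxy, hp, hp', hr⟩ : ∃ x y d : ℕ,
        X.card = x + (y + d) + ((x + d) + y) + (y + (y + d)) ∧ x + d ≤ 3 ^ k * 3 ∧
        y + d ≤ 3 ^ k * 3 ∧ x ≤ 3 * y ∧ 0 < x + (y + d) ∧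
        x + (y + d) + 2 ^ k ≤ 6 * 3 ^ k ∧ d ≤ 1 := by
      set u := 3 ^ k
      set v := 2 ^ k
      refine ⟨(X.card - X.card % 2) / 2 - 2 * min (u * 3 - X.card % 2)
        (((X.card - X.card % 2) / 2 - X.card % 2) / 2) - X.card % 2,
        min (u * 3 - X.card % 2)
        (((X.card - X.card % 2) / 2 - X.card % 2) / 2), X.card % 2, ?_⟩
      refine ⟨?_, ?_, ?_, ?_, ?_, ?_, ?_⟩ <;> omega
    obtain ⟨P, Q, R, hP, hQ, hR, hU, hD⟩ := X.exists_split_three hn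
    refine solvable_fullState_of_balancedState (w := 2 * (k + 1) + 1) hD hU (by omega) (by omega)
      (fun U V hU hV => hb' U V (by omega) (by omega)) (fun U hU => ih U (by omega)) ?_
    exact solvable_balancedState (w := 2 * (k + 1)) (u := 3 ^ k * 3) hD hP hQ hR hx hy hxy hb
      (fun U hU => (solvable_fullState_even (k + 1) U (by rw [pow_succ]; omega)))
      (fun U hU => (solvable_directedState (k + 1) U (by rw [pow_succ]; omega)).mono (by omega)
        fun f c _ h => h)

/-- A balanced state with a small third part `R`, solved with the help of further coins `E`. -/
lemma solvable_balancedState_of_small {w u : ℕ} {P Q R E : Finset (Fin N)}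
    (hD : ∀ z, (z ∈ P → z ∉ Q) ∧ (z ∈ P → z ∉ R) ∧ (z ∈ Q → z ∉ R))
    (hE : ∀ z, z ∈ E → z ∉ P ∧ z ∉ Q ∧ z ∉ R)
    (hP : P.card ≤ 3 * u) (hP' : 2 * u ≤ P.card) (hPQ : P.card = Q.card + R.card)
    (hQ : Q.card ≤ 2 * u) (hR : R.card ≤ u) (hu : 2 * u ≤ E.card)
    (hb : ∀ U V : Finset (Fin N), U.card ≤ u → V.card ≤ u → Solvable w (BipartiteState U V))
    (hf : ∀ U : Finset (Fin N), U.card ≤ u → Solvable w (FullState U))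
    (hd : ∀ U : Finset (Fin N), U.card ≤ 2 * u → Solvable w (DirectedState U)) :
    Solvable (w + 2) (BalancedState P Q R) := by
  obtain ⟨p₁, p₂, p₃, q₁, q₂, hp, hq, hp₁, hp₂, hp₃, hq₁, hq₂, hs⟩ : ∃ p₁ p₂ p₃ q₁ q₂ : ℕ,
      P.card = p₁ + p₂ + p₃ ∧ Q.card = q₁ + q₂ ∧ p₁ ≤ u ∧ p₂ ≤ u ∧ p₃ ≤ u ∧ q₁ ≤ u ∧ q₂ ≤ u ∧
      R.card ≤ p₃ + q₂ := by
    refine ⟨P.card / 3, (P.card + 1) / 3, (P.card + 2) / 3, Q.card / 2, (Q.card + 1) / 2, ?_⟩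
    refine ⟨?_, ?_, ?_, ?_, ?_, ?_, ?_, ?_⟩ <;> omega
  clear hP hP' hPQ hQ
  obtain ⟨P₁, P₂, P₃, hP₁, hP₂, hP₃, hPU, hPD⟩ := P.exists_split_three hp
  obtain ⟨Q₁, Q₂, hQ₁, hQ₂, hQU, hQD⟩ := Q.exists_split hq
  have h₁ : (P₁ ∪ Q₁).card = P₁.card + Q₁.card := card_union_of_forall_notMem (by grind)
  have h₂ : (P₂ ∪ R).card = P₂.card + R.card := card_union_of_forall_notMem (by grind)
  have h₃ : (P₃ ∪ Q₂).card = P₃.card + Q₂.card := card_union_of_forall_notMem (by grind)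
  refine .weigh_padded (A := P₁ ∪ Q₁) (B := P₂ ∪ R) E (by grind) (by omega) (by omega) ?_ ?_ ?_
  · refine .weigh_padded (A := Q₂) (B := P₃) E (by grind) (by omega) (by omega) ?_ ?_ ?_
    · exact (hb P₁ Q₂ (by omega) (by omega)).mono le_rfl
        (by unfold BalancedState BipartiteState; grind)
    · exact (hb P₁ Q₁ (by omega) (by omega)).mono le_rfl
        (by unfold BalancedState BipartiteState; grind)
    · exact (hb P₃ Q₁ (by omega) (by omega)).mono le_rfl
        (by unfold BalancedState BipartiteState; grind)
  · obtain ⟨F, hFE, hF⟩ :=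
      Finset.exists_subset_card_eq (show P₃.card + Q₂.card - R.card ≤ E.card by omega)
    have hFE' : ∀ z, z ∈ F → z ∈ E := hFE
    have h₄ : (R ∪ F).card = R.card + F.card := card_union_of_forall_notMem (by grind)
    refine .weigh (A := P₃ ∪ Q₂) (B := R ∪ F) (Finset.disjoint_left.2 (by grind))
      (by omega) ?_ ?_ ?_
    · exact (hb P₃ Q₂ (by omega) (by omega)).mono le_rfl
        (by unfold BalancedState BipartiteState; grind)
    · exact (hb P₂ Q₁ (by omega) (by omega)).mono le_rfl
        (by unfold BalancedState BipartiteState; grind)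
    · exact (hf R (by omega)).mono le_rfl (by unfold BalancedState FullState; grind)
  · refine .weigh_padded (A := Q₂) (B := R) E (by grind) (by omega) (by omega) ?_ ?_ ?_
    · exact (hb P₂ Q₂ (by omega) (by omega)).mono le_rfl
        (by unfold BalancedState BipartiteState; grind)
    · exact (hd (P₂ ∪ R) (by omega)).mono le_rfl (by unfold BalancedState DirectedState; grind)
    · exact (hf R (by omega)).mono le_rfl (by unfold BalancedState FullState; grind)

lemma solvable_fullState_even_of_le (k : ℕ) (X : Finset (Fin N)) (hX : X.card + 6 ≤ 10 * 3 ^ k) :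
    Solvable (2 * k + 4) (FullState X) := by
  by_cases hXE : X.card ≤ 3 ^ (k + 2) + 1
  · exact (solvable_fullState_even _ X hXE).mono (by omega) fun f c _ h => h
  have hb : ∀ i j (U V : Finset (Fin N)), U.card ≤ 3 ^ i * 3 ^ k → V.card ≤ 3 ^ j * 3 ^ k →
      Solvable (2 * k + (i + j)) (BipartiteState U V) := fun i j U V hU hV =>
    (solvable_bipartiteState (i + k) (j + k) U V (by rwa [pow_add]) (by rwa [pow_add])).mono
      (by omega) fun f c _ h => h
  have hd : ∀ U : Finset (Fin N), U.card ≤ 6 * 3 ^ k → Solvable (k + 1) (DirectedState U) :=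
    fun U hU => solvable_directedState _ U (by rw [pow_succ]; omega)
  have hf : ∀ U : Finset (Fin N), U.card ≤ 3 * 3 ^ k → Solvable (2 * k + 2) (FullState U) :=
    fun U hU => solvable_fullState_even (k + 1) U (by rw [pow_succ]; omega)
  have hf' : ∀ U : Finset (Fin N), U.card ≤ 3 ^ k → Solvable (2 * k) (FullState U) :=
    fun U hU => solvable_fullState_even k U (by omega)
  have hd' : ∀ U : Finset (Fin N), U.card ≤ 2 * 3 ^ k → Solvable (2 * k) (DirectedState U) :=
    fun U hU => (solvable_directedState k U hU).mono (by omega) fun f c _ h => h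
  rw [pow_add] at hXE
  set u := 3 ^ k
  obtain ⟨p, s, hn, hp, hp', hs, hs', hsp⟩ : ∃ p s : ℕ, X.card = p + p + (p + s) ∧ p ≤ 3 * u ∧
      2 * u ≤ p ∧ s ≤ u ∧ p ≤ s + 2 * u ∧ s ≤ p := by
    refine ⟨(X.card - u + 2) / 3, X.card - 3 * ((X.card - u + 2) / 3), ?_⟩
    refine ⟨?_, ?_, ?_, ?_, ?_, ?_⟩ <;> omega
  obtain ⟨P, Q, R, hP, hQ, hR, hU, hD⟩ := X.exists_split_three hn
  have h0 : 0 < u := by positivity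
  refine solvable_fullState_of_balancedState (w := 2 * k + 2) hD hU (by omega) (by omega)
    (fun U V hU hV => hb 1 1 U V (by omega) (by omega)) (fun U hU => hf U (by omega)) ?_
  obtain ⟨R₁, R₂, hR₁, hR₂, hRU, hRD⟩ := R.exists_split hR
  obtain ⟨Q₁, Q₂, hQ₁, hQ₂, hQU, hQD⟩ := Q.exists_split (show Q.card = (p - s) + s by omega)
  have h₁ : (Q₁ ∪ R₂).card = Q₁.card + R₂.card := card_union_of_forall_notMem (by grind)
  have h₂ : (P ∪ R₁).card = P.card + R₁.card := card_union_of_forall_notMem (by grind)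
  refine .weigh (A := R₁) (B := Q₁ ∪ R₂) (Finset.disjoint_left.2 (by grind)) (by omega) ?_ ?_ ?_
  · exact (hf R₁ (by omega)).mono le_rfl (by unfold BalancedState FullState; grind)
  · refine .weigh (A := Q₂) (B := R₂) (Finset.disjoint_left.2 (by grind)) (by omega) ?_ ?_ ?_
    · exact (hb 1 0 P Q₂ (by omega) (by omega)).mono le_rfl
        (by unfold BalancedState BipartiteState; grind)
    · exact (hd (P ∪ R₁) (by omega)).mono (by omega)
        (by unfold BalancedState DirectedState; grind)
    · exact (hb 1 0 R₁ R₂ (by omega) (by omega)).mono le_rfl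
        (by unfold BalancedState BipartiteState; grind)
  · exact (solvable_balancedState_of_small (P := P) (Q := Q₁) (R := R₂) (E := R₁) (w := 2 * k)
      (u := u) (by grind) (by grind) (by omega) (by omega) (by omega) (by omega) (by omega) (by omega)
      (fun U V hU hV => hb 0 0 U V (by omega) (by omega)) hf' hd').mono le_rfl
      (by unfold BalancedState; grind)

/-- The outputs occurring in a strategy. -/
def FCTree.leaves {N : ℕ} : FCTree N → Finset (Finset (Fin N))
  | .output S => {S}
  | .weigh _ _ child => leaves (child .lt) ∪ leaves (child .eq) ∪ leaves (child .gt)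

lemma FCTree.card_leaves_le {N : ℕ} (t : FCTree N) : t.leaves.card ≤ 3 ^ t.depth := by
  induction t with
  | output S => simp [leaves, depth]
  | weigh A B child ih =>
    have h : ∀ o, (child o).depth ≤ max (child .lt).depth
        (max (child .eq).depth (child .gt).depth) := by
      intro o
      cases o <;> omega
    have h' := fun o => (ih o).trans (Nat.pow_le_pow_right (by norm_num) (h o))
    have h₁ := Finset.card_union_le ((child .lt).leaves ∪ (child .eq).leaves) (child .gt).leaves
    have h₂ := Finset.card_union_le (child .lt).leaves (child .eq).leaves
    have := h' .lt
    have := h' .eq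
    have := h' .gt
    simp only [leaves, depth]
    rw [pow_add]
    omega

lemma weighOutcome_true_comm {N : ℕ} (f c : Fin N) (A B : Finset (Fin N)) :
    weighOutcome c f true A B = weighOutcome f c true A B := by
  have : coinWeight c f true = coinWeight f c true := by
    funext x
    unfold coinWeight
    grind
  rw [weighOutcome, weighOutcome, this]

/-- If the chameleon always mimics the fake coin, the two cannot be told apart. -/
lemma FCTree.exists_mem_leaves {N : ℕ} (f c : Fin N) (t : FCTree N) :
    ∃ S ∈ t.leaves, Reaches f c t S ∧ Reaches c f t S := by
  induction t with
  | output S => exact ⟨S, by simp [leaves], .output S, .output S⟩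
  | weigh A B child ih =>
    obtain ⟨S, hS, h₁, h₂⟩ := ih (weighOutcome f c true A B)
    refine ⟨S, ?_, .weigh A B child true S h₁, .weigh A B child true S ?_⟩
    · cases h : weighOutcome f c true A B <;> rw [h] at hS <;> simp [leaves, hS]
    · rwa [weighOutcome_true_comm]

lemma FCAlgorithm.mul_pred_le {N w : ℕ} (h : FCAlgorithm N w) : N * (N - 1) ≤ 2 * 3 ^ w := by
  obtain ⟨t, -, hd, ht⟩ := h
  have hsub : Finset.powersetCard 2 Finset.univ ⊆ t.leaves := by
    intro S hS
    obtain ⟨f, c, hfc, rfl⟩ := Finset.card_eq_two.1 (Finset.mem_powersetCard.1 hS).2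
    obtain ⟨O, hO, h₁, h₂⟩ := t.exists_mem_leaves f c
    have hf := ht f c hfc O h₁
    have hc := ht c f hfc.symm O h₂
    have hfcO : {f, c} ⊆ O := by
      intro x hx
      simp only [Finset.mem_insert, Finset.mem_singleton] at hx
      rcases hx with rfl | rfl
      exacts [hf.2, hc.2]
    rwa [Finset.eq_of_subset_of_card_le hfcO (by rw [Finset.card_pair hfc]; exact hf.1)]
  have hcard := Finset.card_le_card hsub
  rw [Finset.card_powersetCard, Finset.card_univ, Fintype.card_fin, Nat.choose_two_right] at hcard
  have := t.card_leaves_le.trans (Nat.pow_le_pow_right (by norm_num) hd)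
  have := Nat.even_iff.1 (Nat.even_mul_pred_self N)
  omega

lemma not_solvable_of_depth_eq_zero {S : Fin 3 → Fin 3 → Prop} {t : FCTree 3} (h0 : t.depth = 0)
    (hS : ∀ f, ∃ c, f ≠ c ∧ S f c)
    (ht : ∀ f c, f ≠ c → S f c → ∀ O, Reaches f c t O → O.card ≤ 2 ∧ f ∈ O) : False := by
  cases t with
  | output O =>
    have hO : ∀ f, O.card ≤ 2 ∧ f ∈ O := fun f => by
      obtain ⟨c, hfc, hs⟩ := hS f
      exact ht f c hfc hs O (.output O)
    have h2 := (hO 0).1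
    rw [Finset.eq_univ_of_forall fun f => (hO f).2] at h2
    simp at h2
  | weigh A B child =>
    simp only [FCTree.depth] at h0
    omega

lemma exists_ambiguous_weighOutcome : ∀ A B : Finset (Fin 3), Disjoint A B →
    ∃ o : Ordering, ∀ f, ∃ c, f ≠ c ∧ ∃ b, weighOutcome f c b A B = o := by
  have h : ∀ A B : Finset (Fin 3), Disjoint A B →
      (∀ f, ∃ c, f ≠ c ∧ ∃ b, weighOutcome f c b A B = .lt) ∨
      (∀ f, ∃ c, f ≠ c ∧ ∃ b, weighOutcome f c b A B = .eq) ∨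
      ∀ f, ∃ c, f ≠ c ∧ ∃ b, weighOutcome f c b A B = .gt := by
    decide +kernel
  intro A B hd
  rcases h A B hd with h | h | h
  exacts [⟨_, h⟩, ⟨_, h⟩, ⟨_, h⟩]

lemma FCAlgorithm.two_le_of_three {w : ℕ} (h : FCAlgorithm 3 w) : 2 ≤ w := by
  by_contra! hw
  obtain ⟨t, hWF, hd, ht⟩ := h
  cases t with
  | output O =>
    exact not_solvable_of_depth_eq_zero (S := fun _ _ => True) rfl
      (fun f => by simpa using exists_ne f |>.imp fun c hc => hc.symm) fun f c hfc _ => ht f c hfc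
  | weigh A B child =>
    obtain ⟨o, ho⟩ := exists_ambiguous_weighOutcome A B hWF.1
    simp only [FCTree.depth] at hd
    refine not_solvable_of_depth_eq_zero (t := child o)
      (S := fun f c => ∃ b, weighOutcome f c b A B = o) (by cases o <;> omega) ho ?_
    rintro f c hfc ⟨b, rfl⟩ O hO
    exact ht f c hfc O (.weigh A B child b O hO)

lemma FCAlgorithm.two_le {w : ℕ} (hN : 3 ≤ N) (h : FCAlgorithm N w) : 2 ≤ w := by
  by_cases h3 : N = 3
  · subst h3
    exact h.two_le_of_three
  · by_contra! hw
    have h1 := h.mul_pred_le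
    have h2 : 3 ^ w ≤ 3 ^ 1 := Nat.pow_le_pow_right (by norm_num) (by omega)
    have h3 : 4 * 3 ≤ N * (N - 1) := Nat.mul_le_mul (by omega) (by omega)
    omega

lemma fcAlgorithm_of_solvable {w : ℕ} (h : Solvable w (FullState (Finset.univ : Finset (Fin N)))) :
    FCAlgorithm N w := by
  obtain ⟨t, h₁, h₂, h₃⟩ := h
  exact ⟨t, h₁, h₂, fun f c hfc => h₃ f c hfc (Finset.mem_univ f)⟩

lemma fcAlgorithm_FC (N : ℕ) : FCAlgorithm N (FC N) := by
  refine Nat.sInf_mem (s := {w | FCAlgorithm N w}) ⟨2 * N, fcAlgorithm_of_solvable ?_⟩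
  refine solvable_fullState_even N _ ?_
  have := (Nat.lt_pow_self (n := N) (show 1 < 3 by norm_num))
  simp
  omega

lemma sq_le_of_mul_pred_le {K w : ℕ} (hK : 3 ≤ K) (hw : 2 ≤ w) (h : K * (K - 1) ≤ 2 * 3 ^ w) :
    81 * K ^ 2 ≤ 169 * 3 ^ w := by
  obtain ⟨m, rfl⟩ : ∃ m, K = m + 1 := ⟨K - 1, by omega⟩
  simp only [Nat.add_sub_cancel] at h
  by_cases hm : 24 ≤ m
  · nlinarith
  by_cases hw6 : 6 ≤ w
  · have h6 : 3 ^ 6 ≤ 3 ^ w := Nat.pow_le_pow_right (by norm_num) hw6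
    have : (m + 1) ^ 2 ≤ 24 ^ 2 := Nat.pow_le_pow_left (by omega) 2
    omega
  · interval_cases w <;> interval_cases m <;> omega

lemma fcAlgorithm_of_sq_le {W : ℕ} (hW : 4 ≤ W) (h : (162 * N) ^ 2 ≤ 169 ^ 2 * 3 ^ W) :
    FCAlgorithm N W := by
  refine fcAlgorithm_of_solvable ?_
  have hN : (Finset.univ : Finset (Fin N)).card = N := by simp
  rcases Nat.even_or_odd' W with ⟨m, rfl | rfl⟩
  · have h' : 162 * N ≤ 169 * 3 ^ m := by
      rw [mul_comm 2 m, pow_mul, ← mul_pow] at h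
      exact (Nat.pow_le_pow_iff_left (by norm_num)).1 h
    obtain ⟨k, rfl⟩ : ∃ k, m = k + 2 := ⟨m - 2, by omega⟩
    by_cases hE : N ≤ 3 ^ (k + 2) + 1
    · exact solvable_fullState_even _ _ (by omega)
    · refine solvable_fullState_even_of_le k _ ?_
      rw [hN]
      rw [pow_add] at h' hE
      rcases k with _ | _ | k
      · omega
      · omega
      · have : 1 ≤ 3 ^ k := Nat.one_le_pow _ _ (by norm_num)
        rw [pow_add] at *
        omega
  · obtain ⟨k, rfl⟩ : ∃ k, m = k + 2 := ⟨m - 2, by omega⟩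
    refine (solvable_fullState_odd (k + 1) _ ?_).mono (by omega) fun f c _ h => h
    rw [hN]
    have h' : 162 * N ≤ 879 * 3 ^ (k + 1) := by
      refine (Nat.pow_le_pow_iff_left (n := 2) (by norm_num)).1 (h.trans ?_)
      rw [show 2 * (k + 2) + 1 = (k + 1) * 2 + 3 by ring, pow_add, pow_mul]
      nlinarith [Nat.zero_le ((3 ^ (k + 1)) ^ 2)]
    rcases k with _ | k
    · omega
    · have : 2 ^ k ≤ 3 ^ k := Nat.pow_le_pow_left (by norm_num) k
      simp only [pow_succ] at h' ⊢
      omega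

end Components

/-- If N = aK + r with a ≥ 1, K ≥ 2 and 0 ≤ r < a, then
FC(N) ≤ FC(K) + FC(2a + r). -/
theorem fc_subadditive (N a K r : ℕ) (ha : 1 ≤ a) (hK : 2 ≤ K) (hr : r < a)
    (hN : N = a * K + r) : FC N ≤ FC K + FC (2 * a + r) := by
  rcases hK.eq_or_lt with rfl | hK3
  · rw [hN, mul_comm a 2]
    omega
  rcases ha.eq_or_lt with rfl | ha2
  · obtain rfl : r = 0 := by omega
    rw [hN, one_mul, add_zero]
    omega
  have hA := fcAlgorithm_FC K
  have hB := fcAlgorithm_FC (2 * a + r)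
  have hwA := hA.two_le hK3
  have hwB := hB.two_le (by omega)
  have hsA := sq_le_of_mul_pred_le hK3 hwA hA.mul_pred_le
  have hsB := sq_le_of_mul_pred_le (by omega) hwB hB.mul_pred_le
  have hle : 2 * N ≤ K * (2 * a + r) := by
    rw [hN]
    nlinarith [Nat.mul_le_mul_right r hK]
  refine Nat.sInf_le (fcAlgorithm_of_sq_le (by omega) ?_)
  calc (162 * N) ^ 2 = 81 ^ 2 * (2 * N) ^ 2 := by ring
    _ ≤ 81 ^ 2 * (K * (2 * a + r)) ^ 2 := by gcongr
    _ = 81 * K ^ 2 * (81 * (2 * a + r) ^ 2) := by ring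
    _ ≤ 169 * 3 ^ FC K * (169 * 3 ^ FC (2 * a + r)) := Nat.mul_le_mul hsA hsB
    _ = 169 ^ 2 * 3 ^ (FC K + FC (2 * a + r)) := by ring
end

section
/- Upper bound for FC: for every N ≥ 2, FC(N) ≤ 3·log_3 N. -/
/-- The pairs (fake, chameleon) satisfying `P` can be handled in `w` weighings. -/
def SolvableOn {N : ℕ} (w : ℕ) (P : Fin N → Fin N → Prop) : Prop :=
  ∃ t : FCTree N, t.WF ∧ t.depth ≤ w ∧
    ∀ f c : Fin N, f ≠ c → P f c → ∀ S, Reaches f c t S → S.card ≤ 2 ∧ f ∈ S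

namespace SolvableOn

variable {N : ℕ} {w : ℕ} {P Q : Fin N → Fin N → Prop}

theorem mono (h : SolvableOn w Q) (hPQ : ∀ f c, f ≠ c → P f c → Q f c) :
    SolvableOn w P := by
  obtain ⟨t, h1, h2, h3⟩ := h
  exact ⟨t, h1, h2, fun f c hfc hP => h3 f c hfc (hPQ f c hfc hP)⟩

theorem of_card_le_two (w : ℕ) (S : Finset (Fin N)) (hS : S.card ≤ 2)
    (h : ∀ f c, f ≠ c → P f c → f ∈ S) : SolvableOn w P := by
  refine ⟨.output S, trivial, Nat.zero_le _, fun f c hfc hP T hT => ?_⟩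
  cases hT
  exact ⟨hS, h f c hfc hP⟩

end SolvableOn

theorem sum_coinWeight_add {N : ℕ} {f c : Fin N} (hfc : f ≠ c) (b : Bool)
    (A : Finset (Fin N)) :
    (∑ x ∈ A, coinWeight f c b x) + (if f ∈ A then 1 else 0) +
      (if c ∈ A ∧ b = true then 1 else 0) = A.card := by
  have hf : (if f ∈ A then 1 else 0) = ∑ x ∈ A, if x = f then 1 else 0 := by
    simp
  have hc : (if c ∈ A ∧ b = true then 1 else 0) =
      ∑ x ∈ A, if x = c ∧ b = true then 1 else 0 := by
    cases b <;> simp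
  rw [hf, hc, ← Finset.sum_add_distrib, ← Finset.sum_add_distrib, Finset.card_eq_sum_ones]
  refine Finset.sum_congr rfl fun x _ => ?_
  unfold coinWeight
  split_ifs <;> simp_all

/-- What an outcome of a weighing with equally many coins on the pans `A` and `B` says about
the fake coin `f` and the chameleon `c`. -/
def OutcomeInfo {N : ℕ} (A B : Finset (Fin N)) (f c : Fin N) : Ordering → Prop
  | .lt => f ∈ A ∨ (f ∉ B ∧ c ∈ A)
  | .eq => (f ∉ A ∧ f ∉ B) ∨ (f ∈ A ∧ c ∈ B) ∨ (f ∈ B ∧ c ∈ A)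
  | .gt => f ∈ B ∨ (f ∉ A ∧ c ∈ B)

theorem outcomeInfo_weighOutcome {N : ℕ} {A B : Finset (Fin N)} (hAB : Disjoint A B)
    (hcard : A.card = B.card) {f c : Fin N} (hfc : f ≠ c) (b : Bool) :
    OutcomeInfo A B f c (weighOutcome f c b A B) := by
  have hA := sum_coinWeight_add hfc b A
  have hB := sum_coinWeight_add hfc b B
  have hf : f ∈ A → f ∉ B := fun h => Finset.disjoint_left.mp hAB h
  have hc : c ∈ A → c ∉ B := fun h => Finset.disjoint_left.mp hAB h
  unfold weighOutcome
  rcases lt_trichotomy (∑ x ∈ A, coinWeight f c b x) (∑ x ∈ B, coinWeight f c b x)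
    with h | h | h
  · rw [compare_lt_iff_lt.mpr h]
    simp only [OutcomeInfo]
    grind
  · rw [compare_eq_iff_eq.mpr h]
    simp only [OutcomeInfo]
    grind
  · rw [compare_gt_iff_gt.mpr h]
    simp only [OutcomeInfo]
    grind

theorem SolvableOn.weigh {N w : ℕ} {P : Fin N → Fin N → Prop} {A B : Finset (Fin N)}
    (hAB : Disjoint A B) (hcard : A.card = B.card)
    (h : ∀ o, SolvableOn w (fun f c => P f c ∧ OutcomeInfo A B f c o)) :
    SolvableOn (w + 1) P := by
  choose t h1 h2 h3 using h
  refine ⟨.weigh A B t, ⟨hAB, h1⟩, ?_, fun f c hfc hP S hS => ?_⟩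
  · have := h2 .lt
    have := h2 .eq
    have := h2 .gt
    simp only [FCTree.depth]
    omega
  · cases hS with
    | weigh _ _ _ b _ hS =>
      exact h3 _ f c hfc ⟨hP, outcomeInfo_weighOutcome hAB hcard hfc b⟩ S hS

theorem exists_three_piles {α : Type*} [DecidableEq α] (X : Finset α) {n : ℕ}
    (hX : X.card ≤ 3 * n) :
    ∃ A B C : Finset α, Disjoint A B ∧ Disjoint A C ∧ Disjoint B C ∧ A ∪ B ∪ C = X ∧
      A.card = B.card ∧ A.card ≤ n ∧ C.card ≤ n ∧ (C.card ≤ A.card ∨ X.card ≤ 1) := by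
  rcases Nat.lt_or_ge 1 X.card with h | h
  · obtain ⟨A, hA, hAc⟩ := Finset.exists_subset_card_eq (s := X) (n := (X.card + 2) / 3) (by omega)
    have h1 := Finset.card_sdiff_add_card_eq_card hA
    obtain ⟨B, hB, hBc⟩ := Finset.exists_subset_card_eq (s := X \ A)
      (n := (X.card + 2) / 3) (by omega)
    have h2 := Finset.card_sdiff_add_card_eq_card hB
    refine ⟨A, B, (X \ A) \ B, ?_, ?_, ?_, ?_, ?_, ?_, ?_, ?_⟩
    · exact Finset.disjoint_of_subset_right hB Finset.disjoint_sdiff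
    · exact Finset.disjoint_of_subset_right Finset.sdiff_subset Finset.disjoint_sdiff
    · exact Finset.disjoint_sdiff
    · grind
    all_goals omega
  · exact ⟨∅, ∅, X, by simp, by simp, by simp, by simp, rfl, by simp, by omega, Or.inr h⟩

/-- The fake coin is in `U` but the chameleon is not, or the same for `V`. -/
def SeparatedBy {N : ℕ} (U V : Finset (Fin N)) (f c : Fin N) : Prop :=
  (f ∈ U ∧ c ∉ U) ∨ (f ∈ V ∧ c ∉ V)

theorem solvableOn_separatedBy_succ {N w n : ℕ} {U V : Finset (Fin N)} (hU : U.card ≤ 3 * n)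
    (h : ∀ U' : Finset (Fin N), U'.card ≤ n → SolvableOn w (SeparatedBy U' V)) :
    SolvableOn (w + 1) (SeparatedBy U V) := by
  obtain ⟨A, B, C, hAB, hAC, hBC, rfl, hcard, hA, hC, -⟩ := exists_three_piles U hU
  rw [Finset.disjoint_left] at hAC hBC
  have hAB' := Finset.disjoint_left.mp hAB
  refine SolvableOn.weigh hAB hcard fun o => ?_
  cases o
  · refine (h A hA).mono fun f c _ => ?_
    simp only [SeparatedBy, OutcomeInfo]
    grind
  · refine (h C hC).mono fun f c _ => ?_
    simp only [SeparatedBy, OutcomeInfo]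
    grind
  · refine (h B (hcard ▸ hA)).mono fun f c _ => ?_
    simp only [SeparatedBy, OutcomeInfo]
    grind

theorem solvableOn_separatedBy {N : ℕ} (k : ℕ) (U V : Finset (Fin N)) (hU : U.card ≤ 3 ^ k)
    (hV : V.card ≤ 3 ^ k) : SolvableOn (2 * k) (SeparatedBy U V) := by
  induction k generalizing U V with
  | zero =>
    refine SolvableOn.of_card_le_two _ (U ∪ V) ?_ fun f c _ h => ?_
    · have := Finset.card_union_le U V
      omega
    · simp only [SeparatedBy] at h
      grind
  | succ k ih =>
    rw [pow_succ'] at hU hV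
    refine solvableOn_separatedBy_succ (w := 2 * k + 1) hU fun U' hU' => ?_
    have hVU' : SolvableOn (2 * k + 1) (SeparatedBy V U') :=
      solvableOn_separatedBy_succ hV fun V' hV' => ih V' U' hV' hU'
    exact hVU'.mono fun f c _ h => Or.symm h

/-- The situation after `A` has turned out lighter than `B`, the third pile being `C`. -/
theorem solvableOn_of_lighter {N k : ℕ} {A B C : Finset (Fin N)} (hAB : Disjoint A B)
    (hAC : Disjoint A C) (hcard : A.card = B.card) (hCA : C.card ≤ A.card)
    (hA : A.card ≤ 3 ^ k)
    (ih : ∀ X : Finset (Fin N), X.card ≤ 3 ^ k → SolvableOn (2 * k) (fun f _ => f ∈ X)) :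
    SolvableOn (2 * k + 1) (fun f c => f ∈ A ∨ (f ∈ C ∧ c ∈ A)) := by
  obtain ⟨D, hCD, hDB, hD⟩ := Finset.exists_subsuperset_card_eq
    (Finset.subset_union_right (s₁ := B) (s₂ := C)) hCA
    (hcard.le.trans (Finset.card_le_card Finset.subset_union_left))
  have hAD : Disjoint A D :=
    Finset.disjoint_of_subset_right hDB (Finset.disjoint_union_right.mpr ⟨hAB, hAC⟩)
  have hAD' := Finset.disjoint_left.mp hAD
  have hAC' := Finset.disjoint_left.mp hAC
  refine SolvableOn.weigh hAD hD.symm fun o => ?_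
  cases o
  · refine (ih A hA).mono fun f c _ => ?_
    simp only [OutcomeInfo]
    grind
  · refine (solvableOn_separatedBy k A C hA (hCA.trans hA)).mono fun f c _ => ?_
    simp only [OutcomeInfo, SeparatedBy]
    grind
  · refine (ih C (hCA.trans hA)).mono fun f c _ => ?_
    simp only [OutcomeInfo]
    grind

/-- The situation after `A` and `B` have balanced, the third pile being `C`. -/
theorem solvableOn_of_balanced {N k : ℕ} {A B C : Finset (Fin N)} (hAB : Disjoint A B)
    (hAC : Disjoint A C) (hBC : Disjoint B C) (hcard : A.card = B.card) (hCA : C.card ≤ A.card)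
    (hA : A.card ≤ 3 ^ k)
    (ih : ∀ X : Finset (Fin N), X.card ≤ 3 ^ k → SolvableOn (2 * k) (fun f _ => f ∈ X)) :
    SolvableOn (2 * k + 1)
      (fun f c => f ∈ C ∨ (f ∈ A ∧ c ∈ B) ∨ (f ∈ B ∧ c ∈ A)) := by
  obtain ⟨A', hA'A, hA'⟩ := Finset.exists_subset_card_eq hCA
  have hA'C : Disjoint A' C := Finset.disjoint_of_subset_left hA'A hAC
  have hR := Finset.card_sdiff_add_card_eq_card hA'A
  have hCR := Finset.card_union_le C (A \ A')
  have hAB' := Finset.disjoint_left.mp hAB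
  have hAC' := Finset.disjoint_left.mp hAC
  have hBC' := Finset.disjoint_left.mp hBC
  refine SolvableOn.weigh hA'C hA' fun o => ?_
  cases o
  · refine (solvableOn_separatedBy k A B hA (hcard ▸ hA)).mono fun f c _ => ?_
    simp only [OutcomeInfo, SeparatedBy]
    grind
  · refine (solvableOn_separatedBy k (C ∪ (A \ A')) B (by omega) (hcard ▸ hA)).mono
      fun f c _ => ?_
    simp only [OutcomeInfo, SeparatedBy]
    grind
  · refine (ih C (hCA.trans hA)).mono fun f c _ => ?_
    simp only [OutcomeInfo]
    grind

theorem solvableOn_mem {N : ℕ} (k : ℕ) (X : Finset (Fin N)) (hX : X.card ≤ 3 ^ k) :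
    SolvableOn (2 * k) (fun f _ => f ∈ X) := by
  induction k generalizing X with
  | zero => exact SolvableOn.of_card_le_two _ X (by omega) fun f c _ h => h
  | succ k ih =>
    rw [pow_succ'] at hX
    obtain ⟨A, B, C, hAB, hAC, hBC, hABC, hcard, hA, hC, hCA | h1⟩ := exists_three_piles X hX
    · subst hABC
      refine SolvableOn.weigh (w := 2 * k + 1) hAB hcard fun o => ?_
      cases o
      · refine (solvableOn_of_lighter hAB hAC hcard hCA hA ih).mono fun f c _ => ?_
        simp only [OutcomeInfo]
        grind
      · refine (solvableOn_of_balanced hAB hAC hBC hcard hCA hA ih).mono fun f c _ => ?_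
        simp only [OutcomeInfo]
        grind
      · refine (solvableOn_of_lighter hAB.symm hBC hcard.symm (hcard ▸ hCA) (hcard ▸ hA)
          ih).mono fun f c _ => ?_
        simp only [OutcomeInfo]
        grind
    · exact SolvableOn.of_card_le_two _ X (by omega) fun f c _ h => h

theorem FC_le_of_solvableOn {N w : ℕ} (h : SolvableOn (N := N) w fun _ _ => True) :
    FC N ≤ w := by
  obtain ⟨t, h1, h2, h3⟩ := h
  exact Nat.sInf_le ⟨t, h1, h2, fun f c hfc => h3 f c hfc trivial⟩

theorem FC_two : FC 2 = 0 :=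
  Nat.le_zero.mp <| FC_le_of_solvableOn <|
    SolvableOn.of_card_le_two 0 Finset.univ (by simp) fun _ _ _ _ => Finset.mem_univ _

theorem FC_four_le : FC 4 ≤ 3 := by
  refine FC_le_of_solvableOn (SolvableOn.weigh (A := {0, 1}) (B := {2, 3}) (w := 2)
    (by decide) (by decide) fun o => ?_)
  cases o
  · refine SolvableOn.of_card_le_two 2 {0, 1} (by decide) ?_
    simp only [OutcomeInfo, true_and]
    decide
  · refine (solvableOn_separatedBy 1 {0, 1} {2, 3} (by decide) (by decide)).mono ?_
    simp only [OutcomeInfo, SeparatedBy, true_and]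
    decide
  · refine SolvableOn.of_card_le_two 2 {2, 3} (by decide) ?_
    simp only [OutcomeInfo, true_and]
    decide

theorem FC_le_two_mul {N k : ℕ} (h : N ≤ 3 ^ k) : FC N ≤ 2 * k :=
  FC_le_of_solvableOn <|
    (solvableOn_mem k Finset.univ (by simpa using h)).mono fun _ _ _ _ => Finset.mem_univ _

theorem three_pow_FC_le (N : ℕ) (hN : 2 ≤ N) : 3 ^ FC N ≤ N ^ 3 := by
  by_cases h2 : N = 2
  · subst h2
    simp [FC_two]
  by_cases h4 : N = 4
  · subst h4
    exact (Nat.pow_le_pow_right (by norm_num) FC_four_le).trans (by norm_num)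
  have hle : N ≤ 3 ^ Nat.clog 3 N := Nat.le_pow_clog (by norm_num) N
  have hlt : 3 ^ (Nat.clog 3 N).pred < N := Nat.pow_pred_clog_lt_self (by norm_num) (by omega)
  generalize Nat.clog 3 N = k at hle hlt
  refine (Nat.pow_le_pow_right (by norm_num) (FC_le_two_mul hle)).trans ?_
  match k, hle, hlt with
  | 0, hle, _ => omega
  | 1, _, _ => exact le_trans (by norm_num) (Nat.pow_le_pow_left (show 3 ≤ N by omega) 3)
  | 2, _, hlt =>
    simp only [Nat.pred_succ] at hlt
    exact le_trans (by norm_num) (Nat.pow_le_pow_left (show 5 ≤ N by omega) 3)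
  | k + 3, _, hlt =>
    calc 3 ^ (2 * (k + 3)) ≤ 3 ^ ((k + 2) * 3) := Nat.pow_le_pow_right (by norm_num) (by omega)
      _ = (3 ^ (k + 2)) ^ 3 := pow_mul _ _ _
      _ ≤ N ^ 3 := Nat.pow_le_pow_left hlt.le 3

/-- Upper bound for FC: for every N ≥ 2, FC(N) ≤ 3·log₃ N. -/
theorem fc_upper_bound (N : ℕ) (hN : 2 ≤ N) :
    (FC N : ℝ) ≤ 3 * Real.logb 3 N := by
  have h : (3 : ℝ) ^ (FC N : ℝ) ≤ (N : ℝ) ^ 3 := by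
    rw [Real.rpow_natCast]
    exact_mod_cast three_pow_FC_le N hN
  have hpos : (0 : ℝ) < (N : ℝ) ^ 3 := by positivity
  have := (Real.le_logb_iff_rpow_le (by norm_num) hpos).mpr h
  rwa [Real.logb_pow] at this
end

section
/- The value D is invariant: for any state graph G and any weighing with pans A and B, each double edge of G survives in exactly one of the three outcome graphs; hence the sum over the three outcomes of the number of double edges equals the number of double edges of G. -/
/-- In the state graph `G` (a directed graph with loops on the finite vertex
set `V`, recorded as a finset of ordered pairs), the outcome graph of a
balanced weighing with pans `A` and `B`: keep exactly those edges of `G` that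
go from `A` to `B`, or from `B` to `A`, or start in the leftover set `C`
(vertices in neither pan); in particular exactly the loops at vertices of `C`
are kept. -/
def balancedGraph {V : Type*} [DecidableEq V] (G : Finset (V × V))
    (A B : Finset V) : Finset (V × V) :=
  G.filter (fun e => (e.1 ∈ A ∧ e.2 ∈ B) ∨ (e.1 ∈ B ∧ e.2 ∈ A) ∨
    (e.1 ∉ A ∧ e.1 ∉ B))

/-- The outcome graph when pan `A` is lighter: keep exactly those edges of `G`
that start in `A` or go from the leftover set `C` to `A`; in particular exactly
the loops at vertices of `A` are kept. -/
def leftLighterGraph {V : Type*} [DecidableEq V] (G : Finset (V × V))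
    (A B : Finset V) : Finset (V × V) :=
  G.filter (fun e => e.1 ∈ A ∨ ((e.1 ∉ A ∧ e.1 ∉ B) ∧ e.2 ∈ A))

/-- The outcome graph when pan `B` is lighter: keep exactly those edges of `G`
that start in `B` or go from the leftover set `C` to `B`; in particular exactly
the loops at vertices of `B` are kept. -/
def rightLighterGraph {V : Type*} [DecidableEq V] (G : Finset (V × V))
    (A B : Finset V) : Finset (V × V) :=
  G.filter (fun e => e.1 ∈ B ∨ ((e.1 ∉ A ∧ e.1 ∉ B) ∧ e.2 ∈ B))

/-- The unordered pair `{a, b}` (with `a ≠ b`) is a double edge of `G` if both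
`a→b` and `b→a` are edges of `G`. -/
def IsDoubleEdge {V : Type*} (G : Finset (V × V)) (a b : V) : Prop :=
  a ≠ b ∧ (a, b) ∈ G ∧ (b, a) ∈ G

/-- `D`, the number of double edges of `G`: the number of ordered pairs
`(a, b)` with `a ≠ b` and both `a→b` and `b→a` edges of `G`, divided by two. -/
def doubleEdgeCount {V : Type*} [DecidableEq V] (G : Finset (V × V)) : ℕ :=
  (G.filter (fun e => e.1 ≠ e.2 ∧ (e.2, e.1) ∈ G)).card / 2

/-- `F`, the number of loops of `G`. -/
def loopCount {V : Type*} [DecidableEq V] (G : Finset (V × V)) : ℕ :=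
  (G.filter (fun e => e.1 = e.2)).card

/-- The ordered pairs `(a, b)` such that `{a, b}` is a double edge of `G`. -/
def doubleEdgePairs {V : Type*} [DecidableEq V] (G : Finset (V × V)) : Finset (V × V) :=
  G.filter (fun e => e.1 ≠ e.2 ∧ (e.2, e.1) ∈ G)

theorem mem_doubleEdgePairs {V : Type*} [DecidableEq V] {G : Finset (V × V)} {e : V × V} :
    e ∈ doubleEdgePairs G ↔ IsDoubleEdge G e.1 e.2 := by
  simp only [doubleEdgePairs, IsDoubleEdge, Finset.mem_filter]
  tauto

theorem IsDoubleEdge.symm {V : Type*} {G : Finset (V × V)} {a b : V}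
    (h : IsDoubleEdge G a b) : IsDoubleEdge G b a :=
  ⟨h.1.symm, h.2.2, h.2.1⟩

theorem IsDoubleEdge.mono {V : Type*} {G H : Finset (V × V)} (hGH : G ⊆ H) {a b : V}
    (h : IsDoubleEdge G a b) : IsDoubleEdge H a b :=
  ⟨h.1, hGH h.2.1, hGH h.2.2⟩

theorem even_card_doubleEdgePairs {V : Type*} [DecidableEq V] (G : Finset (V × V)) :
    Even (doubleEdgePairs G).card := by
  have h : ∑ _e ∈ doubleEdgePairs G, (1 : ZMod 2) = 0 :=
    Finset.sum_involution (fun e _ => e.swap) (fun _ _ => by decide)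
      (fun e he _ h => (mem_doubleEdgePairs.1 he).1 (congrArg Prod.snd h))
      (fun e he => mem_doubleEdgePairs.2 (mem_doubleEdgePairs.1 he).symm)
      (fun e _ => e.swap_swap)
  rwa [Finset.sum_const, nsmul_one, ZMod.natCast_eq_zero_iff_even] at h

theorem doubleEdgeCount_add_self {V : Type*} [DecidableEq V] (G : Finset (V × V)) :
    doubleEdgeCount G + doubleEdgeCount G = (doubleEdgePairs G).card := by
  have h := Nat.div_two_mul_two_of_even (even_card_doubleEdgePairs G)
  change (doubleEdgePairs G).card / 2 + (doubleEdgePairs G).card / 2 = _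
  omega

/-- Each double edge survives in exactly one of the three outcome graphs. -/
theorem IsDoubleEdge.survives_in_exactly_one {V : Type*} [DecidableEq V]
    {G : Finset (V × V)} {A B : Finset V} (hAB : Disjoint A B) {a b : V}
    (h : IsDoubleEdge G a b) :
    (IsDoubleEdge (balancedGraph G A B) a b ∧
        ¬ IsDoubleEdge (leftLighterGraph G A B) a b ∧
        ¬ IsDoubleEdge (rightLighterGraph G A B) a b) ∨
      (¬ IsDoubleEdge (balancedGraph G A B) a b ∧
        IsDoubleEdge (leftLighterGraph G A B) a b ∧
        ¬ IsDoubleEdge (rightLighterGraph G A B) a b) ∨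
      (¬ IsDoubleEdge (balancedGraph G A B) a b ∧
        ¬ IsDoubleEdge (leftLighterGraph G A B) a b ∧
        IsDoubleEdge (rightLighterGraph G A B) a b) := by
  have ha : a ∈ A → a ∉ B := fun h => Finset.disjoint_left.1 hAB h
  have hb : b ∈ A → b ∉ B := fun h => Finset.disjoint_left.1 hAB h
  obtain ⟨hne, hab, hba⟩ := h
  simp only [IsDoubleEdge, balancedGraph, leftLighterGraph, rightLighterGraph,
    Finset.mem_filter, hne, hab, hba, ne_eq, not_false_eq_true, true_and]
  by_cases haA : a ∈ A <;> by_cases haB : a ∈ B <;> by_cases hbA : b ∈ A <;>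
    by_cases hbB : b ∈ B <;> simp_all

theorem card_doubleEdgePairs_outcomes {V : Type*} [DecidableEq V]
    (G : Finset (V × V)) (A B : Finset V) (hAB : Disjoint A B) :
    (doubleEdgePairs (balancedGraph G A B)).card +
        (doubleEdgePairs (leftLighterGraph G A B)).card +
        (doubleEdgePairs (rightLighterGraph G A B)).card =
      (doubleEdgePairs G).card := by
  have hbal {a b : V} : IsDoubleEdge (balancedGraph G A B) a b → IsDoubleEdge G a b :=
    IsDoubleEdge.mono (Finset.filter_subset _ _)
  have hleft {a b : V} : IsDoubleEdge (leftLighterGraph G A B) a b → IsDoubleEdge G a b :=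
    IsDoubleEdge.mono (Finset.filter_subset _ _)
  have hright {a b : V} : IsDoubleEdge (rightLighterGraph G A B) a b → IsDoubleEdge G a b :=
    IsDoubleEdge.mono (Finset.filter_subset _ _)
  rw [← Finset.card_union_of_disjoint, ← Finset.card_union_of_disjoint]
  · congr 1
    ext e
    simp only [Finset.mem_union, mem_doubleEdgePairs]
    have := @IsDoubleEdge.survives_in_exactly_one V _ G A B hAB e.1 e.2
    have := @hbal e.1 e.2
    have := @hleft e.1 e.2
    have := @hright e.1 e.2
    tauto
  · refine Finset.disjoint_left.2 fun e he he' => ?_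
    simp only [Finset.mem_union, mem_doubleEdgePairs] at he he'
    have := (hright he').survives_in_exactly_one hAB
    tauto
  · refine Finset.disjoint_left.2 fun e he he' => ?_
    simp only [mem_doubleEdgePairs] at he he'
    have := (hbal he).survives_in_exactly_one hAB
    tauto

/-- The value D is invariant: for any state graph `G` and any weighing with
disjoint pans `A` and `B`, each double edge of `G` survives in exactly one of
the three outcome graphs; hence the sum over the three outcomes of the number
of double edges equals the number of double edges of `G`. -/
theorem doubleEdgeCount_invariant {V : Type*} [DecidableEq V]
    (G : Finset (V × V)) (A B : Finset V) (hAB : Disjoint A B) :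
    (∀ a b : V, IsDoubleEdge G a b →
      ((IsDoubleEdge (balancedGraph G A B) a b ∧
          ¬ IsDoubleEdge (leftLighterGraph G A B) a b ∧
          ¬ IsDoubleEdge (rightLighterGraph G A B) a b) ∨
        (¬ IsDoubleEdge (balancedGraph G A B) a b ∧
          IsDoubleEdge (leftLighterGraph G A B) a b ∧
          ¬ IsDoubleEdge (rightLighterGraph G A B) a b) ∨
        (¬ IsDoubleEdge (balancedGraph G A B) a b ∧
          ¬ IsDoubleEdge (leftLighterGraph G A B) a b ∧
          IsDoubleEdge (rightLighterGraph G A B) a b))) ∧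
    doubleEdgeCount (balancedGraph G A B) +
        doubleEdgeCount (leftLighterGraph G A B) +
        doubleEdgeCount (rightLighterGraph G A B) =
      doubleEdgeCount G := by
  refine ⟨fun a b h => h.survives_in_exactly_one hAB, ?_⟩
  have h := card_doubleEdgePairs_outcomes G A B hAB
  simp only [← doubleEdgeCount_add_self] at h
  omega
end
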